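/- For every integer k > 4, the hypercube wiring — the Cayley wiring on the group H = (Z/2Z)^k with connection set S the k standard basis vectors — is not stable for the uniform (2^k, k)-BDNF game. -/

import Mathlib

namespace BDNF

variable {V : Type} [DecidableEq V]

/-- `connIn s m v u` : there is a directed path with at most `m` edges from `v`
to `u` in the directed graph defined by the wiring `s`. -/
def connIn (s : V → Finset V) : ℕ → V → V → Prop
  | 0, v, u => v = u
  | m + 1, v, u => v = u ∨ ∃ w ∈ s v, connIn s m w u

/-- Directed hop distance from `v` to `u`, with disconnection penalty `M`. -/
noncomputable def distW (s : V → Finset V) (M : ℕ) (v u : V) : ℕ := by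
  classical exact if h : ∃ m, connIn s m v u then Nat.find h else M

/-- Cost of node `v` in the uniform game: the sum of its distances to all
other nodes. -/
noncomputable def cost [Fintype V] (s : V → Finset V) (M : ℕ) (v : V) : ℕ :=
  ∑ u ∈ Finset.univ.filter (fun u => u ≠ v), distW s M v u

/-- `s` is a wiring with out-degree bound `k`: every node links to at most `k`
other nodes. -/
def IsWiring (k : ℕ) (s : V → Finset V) : Prop :=
  ∀ v, v ∉ s v ∧ (s v).card ≤ k

/-- `s` is stable (a pure Nash equilibrium) for the uniform game: no node can
strictly decrease its cost by rewiring its own out-links. -/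
def Stable [Fintype V] (k M : ℕ) (s : V → Finset V) : Prop :=
  ∀ (v : V) (t : Finset V), v ∉ t → t.card ≤ k →
    cost s M v ≤ cost (Function.update s v t) M v

/-- The Cayley wiring on an additive group `H` with connection set `S`:
node `v` links to `v + a` for each `a ∈ S`. -/
def cayley {H : Type} [AddCommGroup H] [DecidableEq H] (S : Finset H) :
    H → Finset H :=
  fun v => S.image (fun a => v + a)

lemma distW_le {α : Type} {s : α → Finset α} {M m : ℕ} {v u : α} (h : connIn s m v u) :
    distW s M v u ≤ m := by
  classical
  have h' : ∃ m, connIn s m v u := ⟨m, h⟩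
  rw [distW, dif_pos h']
  exact Nat.find_min' h' h

lemma le_distW {α : Type} {s : α → Finset α} {M b : ℕ} {v u : α} (hM : b ≤ M)
    (h : ∀ m, connIn s m v u → b ≤ m) : b ≤ distW s M v u := by
  classical
  rw [distW]
  split_ifs with h'
  · exact h _ (Nat.find_spec h')
  · exact hM

/-- The connection set of the hypercube wiring. -/
abbrev stdBasis (k : ℕ) : Finset (Fin k → ZMod 2) :=
  Finset.univ.image (fun i : Fin k => (Pi.single i 1 : Fin k → ZMod 2))

lemma mem_cayley_stdBasis {k : ℕ} {v w : Fin k → ZMod 2} :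
    w ∈ cayley (stdBasis k) v ↔ ∃ i, v + Pi.single i 1 = w := by
  simp only [cayley, Finset.mem_image, Finset.mem_univ, true_and, exists_exists_eq_and]

lemma hammingDist_add_single_le_one {k : ℕ} (v : Fin k → ZMod 2) (i : Fin k) :
    hammingDist v (v + Pi.single i 1) ≤ 1 := by
  rw [hammingDist, ← Finset.card_singleton i]
  refine Finset.card_le_card fun j hj => ?_
  by_contra hne
  simp_all

lemma hammingDist_add_single_lt {k : ℕ} {v u : Fin k → ZMod 2} {i : Fin k} (h : v i ≠ u i) :
    hammingDist (v + Pi.single i 1) u < hammingDist v u := by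
  have flip : ∀ a b : ZMod 2, a ≠ b → a + 1 = b := by decide
  refine Finset.card_lt_card (Finset.ssubset_iff_of_subset ?_ |>.2 ⟨i, ?_, ?_⟩)
  · intro j hj
    by_cases hji : j = i
    · subst hji
      simpa using h
    · simpa [hji] using hj
  · simpa using h
  · simpa using flip _ _ h

lemma hammingDist_le_of_connIn {k m : ℕ} {v u : Fin k → ZMod 2}
    (h : connIn (cayley (stdBasis k)) m v u) : hammingDist v u ≤ m := by
  induction m generalizing v with
  | zero => simp [show v = u from h]
  | succ m ih =>
    rcases h with rfl | ⟨w, hw, h⟩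
    · simp
    · obtain ⟨i, rfl⟩ := mem_cayley_stdBasis.1 hw
      have := hammingDist_triangle v (v + Pi.single i 1) u
      have := hammingDist_add_single_le_one v i
      have := ih h
      omega

/-- Between distinct nonzero nodes of the hypercube there is a distance-decreasing step that
avoids the origin. -/
lemma exists_flip_ne_zero {k : ℕ} {v u : Fin k → ZMod 2} (hu : u ≠ 0) (hvu : v ≠ u) :
    ∃ i, v i ≠ u i ∧ v + Pi.single i 1 ≠ 0 := by
  by_cases h : ∃ i, u i ≠ 0 ∧ v i = 0
  · obtain ⟨i, hi, hv⟩ := h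
    refine ⟨i, fun e => hi (e ▸ hv), fun e => ?_⟩
    simpa [hv] using congrFun e i
  · push Not at h
    obtain ⟨i, hi⟩ := Function.ne_iff.1 hvu
    obtain ⟨j, hj⟩ := Function.ne_iff.1 hu
    refine ⟨i, hi, fun e => ?_⟩
    have hji : j ≠ i := by
      rintro rfl
      have two : ∀ a b : ZMod 2, a ≠ b → b ≠ 0 → a = 0 := by decide
      exact h j hj (two _ _ hi hj)
    exact h j hj (by simpa [hji] using congrFun e j)

lemma connIn_update_of_hammingDist_le {k m : ℕ} {t : Finset (Fin k → ZMod 2)}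
    {v u : Fin k → ZMod 2} (hv : v ≠ 0) (hu : u ≠ 0) (h : hammingDist v u ≤ m) :
    connIn (Function.update (cayley (stdBasis k)) 0 t) m v u := by
  induction m generalizing v with
  | zero => exact hammingDist_eq_zero.1 (Nat.le_zero.1 h)
  | succ m ih =>
    by_cases hvu : v = u
    · exact Or.inl hvu
    · obtain ⟨i, hi, h0⟩ := exists_flip_ne_zero hu hvu
      refine Or.inr ⟨v + Pi.single i 1, ?_, ih h0 ?_⟩
      · rw [Function.update_of_ne hv]
        exact mem_cayley_stdBasis.2 ⟨i, rfl⟩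
      · have := hammingDist_add_single_lt hi
        omega

lemma distW_update_le {k m M : ℕ} {t : Finset (Fin k → ZMod 2)} {w u : Fin k → ZMod 2}
    (hw : w ∈ t) (hw0 : w ≠ 0) (hu : u ≠ 0) (h : hammingDist w u ≤ m) :
    distW (Function.update (cayley (stdBasis k)) 0 t) M 0 u ≤ m + 1 :=
  distW_le (Or.inr ⟨w, by simpa using hw, connIn_update_of_hammingDist_le hw0 hu h⟩)

/-- For every `k > 4`, the hypercube wiring — the Cayley wiring on
`(ℤ/2ℤ)^k` whose connection set consists of the `k` standard basis vectors —
is not stable for the uniform `(2^k, k)`-BDNF game. -/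
theorem stmt_3 :
    ∀ k : ℕ, 4 < k → ∀ M : ℕ, (2 ^ k) ^ 2 < M →
      ¬ Stable k M
        (cayley (Finset.univ.image
          (fun i : Fin k => (Pi.single i 1 : Fin k → ZMod 2)))) := by
  intro k hk M hM hstable
  have hkM : k ≤ M := by
    have h1 : k < 2 ^ k := Nat.lt_two_pow_self
    nlinarith
  let j : Fin k := ⟨0, by omega⟩
  let l : Fin k := ⟨1, by omega⟩
  have hlj : l ≠ j := by simp [l, j]
  let e : Fin k → Fin k → ZMod 2 := fun i => Pi.single i 1
  have he : ∀ i, e i ≠ 0 := fun i => by simp [e]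
  have h1 : (1 : Fin k → ZMod 2) ≠ 0 := fun h => by simpa using congrFun h j
  have h1j : (1 : Fin k → ZMod 2) ≠ e j := fun h => by
    simpa [e, hlj] using congrFun h l
  let f : Fin k → Fin k → ZMod 2 := fun i => if i = j then 1 else e i
  let t : Finset (Fin k → ZMod 2) := Finset.univ.image f
  have hmem1 : 1 ∈ t := Finset.mem_image.2 ⟨j, by simp, by simp [f]⟩
  have hmem : ∀ i, i ≠ j → e i ∈ t := fun i hi =>
    Finset.mem_image.2 ⟨i, by simp, by simp [f, hi]⟩
  have h0t : (0 : Fin k → ZMod 2) ∉ t := by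
    intro h
    obtain ⟨i, -, hi⟩ := Finset.mem_image.1 h
    by_cases hij : i = j
    · exact h1 (by simpa [f, hij] using hi)
    · exact he i (by simpa [f, hij] using hi)
  have hcost : cost (cayley (stdBasis k)) M 0 ≤
      cost (Function.update (cayley (stdBasis k)) 0 t) M 0 := hstable 0 t h0t (Finset.card_image_le.trans (by simp))
  have hold : ∀ u : Fin k → ZMod 2,
      hammingDist 0 u ≤ distW (cayley (stdBasis k)) M 0 u := fun u =>
    le_distW ((hammingDist_le_card_fintype.trans (by simp)).trans hkM)
      fun _ h => hammingDist_le_of_connIn h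
  have hstep : ∀ (u : Fin k → ZMod 2) (i : Fin k), u i ≠ 0 →
      hammingDist (e i) u < hammingDist 0 u := fun u i hi => by
    simpa [e] using hammingDist_add_single_lt (v := 0) (u := u) (i := i) (by simpa using hi.symm)
  have hterm : ∀ u ∈ Finset.univ.filter (fun u : Fin k → ZMod 2 => u ≠ 0),
      distW (Function.update (cayley (stdBasis k)) 0 t) M 0 u + (if u = 1 then 4 else 0) ≤
        distW (cayley (stdBasis k)) M 0 u + (if u = e j then 2 else 0) := by
    intro u hu
    replace hu : u ≠ 0 := by simpa using hu
    have hou := hold u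
    by_cases hu1 : u = 1
    · subst hu1
      have hnew := distW_update_le (M := M) (m := 0) hmem1 h1 h1 (by simp)
      have hnorm : hammingDist (0 : Fin k → ZMod 2) 1 = k := by simp [hammingDist]
      simp only [if_true, h1j, if_false]
      omega
    by_cases huj : u = e j
    · subst huj
      have hdist : hammingDist (e l) (e j) ≤ 2 := by
        have := hammingDist_triangle (e l) 0 (e j)
        have hl := hammingDist_add_single_le_one 0 l
        have hj := hammingDist_add_single_le_one 0 j
        rw [zero_add] at hl hj
        rw [hammingDist_comm (e l) 0] at this
        exact this.trans (add_le_add hl hj)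
      have hnew := distW_update_le (M := M) (hmem l hlj) (he l) (he j) hdist
      have hpos : 0 < hammingDist 0 (e j) := hammingDist_pos.2 (he j).symm
      simp only [hu1, if_true, if_false]
      omega
    · obtain ⟨i, hij, hi⟩ : ∃ i, i ≠ j ∧ u i ≠ 0 := by
        by_contra! hcon
        obtain ⟨i, hi⟩ := Function.ne_iff.1 hu
        have hij : i = j := by
          by_contra hij
          exact hi (hcon i hij)
        rw [hij] at hi
        apply huj
        funext a
        by_cases ha : a = j
        · have two : ∀ b : ZMod 2, b ≠ 0 → b = 1 := by decide
          subst ha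
          simpa [e] using two _ hi
        · simpa [e, ha] using hcon a ha
      have hnew := distW_update_le (M := M) (hmem i hij) (he i) hu le_rfl
      have := hstep u i hi
      simp only [hu1, huj, if_false]
      omega
  have hsum := Finset.sum_le_sum hterm
  rw [Finset.sum_add_distrib, Finset.sum_add_distrib, Finset.sum_ite_eq', Finset.sum_ite_eq',
    if_pos (by simpa using h1), if_pos (by simpa using he j)] at hsum
  unfold cost at hcost
  omega

end BDNF
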